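/- arXiv:2508.05426 — 3 statements merged into one kernel-verified Lean document; each statement's English description precedes it below -/
import Mathlib

section
/- Let Λ, α, t be positive integers with Λ > α ≥ t and let 𝒜 be a t-(Λ, α, 1) design on X = {1, …, Λ}. Let T′ be a (t+1)-element subset of X that is not contained in any block of 𝒜. Then T′ occurs as a non-star entry of the array P_{Λ,t} exactly t+1 times: the set of positions (λ, (A, U)) with λ ∈ X, A ∈ 𝒜, U ⊆ A, |U| = t, λ ∉ A, and {λ} ∪ U = T′ has cardinality exactly t+1. -/
/-- A `t`-`(Λ, α, m)` design on the point set `X = {1, …, Λ}`: a family `𝒜` of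
`α`-element subsets (blocks) of `X` such that every `t`-element subset of `X`
is contained in exactly `m` blocks. -/
def IsDesign (Λ α t m : ℕ) (𝒜 : Finset (Finset ℕ)) : Prop :=
  (∀ A ∈ 𝒜, A ⊆ Finset.Icc 1 Λ ∧ A.card = α) ∧
  ∀ T ⊆ Finset.Icc 1 Λ, T.card = t → (𝒜.filter fun A => T ⊆ A).card = m

/-- A `(t+1)`-subset `T'` of `{1, …, Λ}` not contained in any block of a
`t`-`(Λ, α, 1)` design occurs as a non-star entry of the array `P_{Λ,t}`
exactly `t + 1` times. -/
theorem uncovered_subset_occurs_t_add_one_times (Λ α t : ℕ) (hΛ : 0 < Λ) (hα : 0 < α)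
    (ht : 0 < t) (hαΛ : α < Λ) (htα : t ≤ α) (𝒜 : Finset (Finset ℕ))
    (hd : IsDesign Λ α t 1 𝒜)
    (T' : Finset ℕ) (hT'sub : T' ⊆ Finset.Icc 1 Λ) (hT'card : T'.card = t + 1)
    (hT'block : ∀ A ∈ 𝒜, ¬ T' ⊆ A) :
    {p : ℕ × Finset ℕ × Finset ℕ |
        p.1 ∈ Finset.Icc 1 Λ ∧ p.2.1 ∈ 𝒜 ∧ p.2.2 ⊆ p.2.1 ∧ p.2.2.card = t ∧
        p.1 ∉ p.2.1 ∧ insert p.1 p.2.2 = T'}.ncard = t + 1 := by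
  have key : ∀ x ∈ T', ∃ A ∈ 𝒜, T'.erase x ⊆ A ∧ ∀ B ∈ 𝒜, T'.erase x ⊆ B → B = A := by
    intro x hx
    have h := hd.2 (T'.erase x) ((Finset.erase_subset _ _).trans hT'sub)
      (by rw [Finset.card_erase_of_mem hx, hT'card]; rfl)
    obtain ⟨A, hA⟩ := Finset.card_eq_one.1 h
    have hA' : ∀ B, (B ∈ 𝒜 ∧ T'.erase x ⊆ B) ↔ B = A := by
      intro B
      rw [← Finset.mem_filter (p := fun A => T'.erase x ⊆ A), hA, Finset.mem_singleton]
    have hAA := (hA' A).2 rfl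
    exact ⟨A, hAA.1, hAA.2, fun B hB hB2 => (hA' B).1 ⟨hB, hB2⟩⟩
  choose! F hF hsub huniq using key
  have himg : {p : ℕ × Finset ℕ × Finset ℕ |
        p.1 ∈ Finset.Icc 1 Λ ∧ p.2.1 ∈ 𝒜 ∧ p.2.2 ⊆ p.2.1 ∧ p.2.2.card = t ∧
        p.1 ∉ p.2.1 ∧ insert p.1 p.2.2 = T'} =
      (fun x => (x, F x, T'.erase x)) '' (T' : Set ℕ) := by
    ext ⟨x, A, U⟩
    simp only [Set.mem_ofPred_eq, Set.mem_image, Finset.mem_coe, Prod.mk.injEq]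
    constructor
    · rintro ⟨_, hA, hUA, _, hxA, hins⟩
      have hxT : x ∈ T' := hins ▸ Finset.mem_insert_self x U
      have hU : T'.erase x = U := by
        rw [← hins, Finset.erase_insert (fun h => hxA (hUA h))]
      exact ⟨x, hxT, rfl, (huniq x hxT A hA (hU ▸ hUA)).symm, hU⟩
    · rintro ⟨y, hy, rfl, rfl, rfl⟩
      refine ⟨hT'sub hy, hF y hy, hsub y hy, ?_, ?_, Finset.insert_erase hy⟩
      · rw [Finset.card_erase_of_mem hy, hT'card]; rfl
      · intro hmem
        apply hT'block _ (hF y hy)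
        rw [← Finset.insert_erase hy]
        exact Finset.insert_subset hmem (hsub y hy)
  rw [himg, Set.ncard_image_of_injective _ (fun a b h => (Prod.mk.inj h).1),
    Set.ncard_coe_finset, hT'card]
end

section
/- Let Λ, α, t be positive integers with Λ > α ≥ t and let 𝒜 be a t-(Λ, α, 1) design on X = {1, …, Λ}. Then the array P_{Λ,t} is a (t+1)-regular (C(Λ,t), Λ, C(Λ,t)·(Λ−α)/(t+1)) MapReduce Array: it has Λ rows and C(Λ, t) columns; every non-star value that appears in the array appears exactly t+1 times; and for any two distinct positions carrying equal non-star entries, these positions lie in distinct rows and distinct columns and the two cross positions (same row as one, same column as the other) both carry the star symbol. -/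
/-- The array `P_{Λ,t}` obtained from a `t`-`(Λ, α, 1)` design is a `(t+1)`-regular
`(C(Λ,t), Λ, C(Λ,t)·(Λ−α)/(t+1))` MapReduce Array: it has `Λ` rows and `C(Λ, t)`
columns; every non-star value appearing in the array appears exactly `t+1` times;
for any two distinct positions carrying equal non-star entries, the positions lie in
distinct rows and distinct columns and the two cross positions carry stars; and the
number of distinct non-star values `S` satisfies `(t+1)·S = C(Λ,t)·(Λ−α)`. -/
theorem array_is_MRA (Λ α t : ℕ) (hΛ : 0 < Λ) (hα : 0 < α)
    (ht : 0 < t) (hαΛ : α < Λ) (htα : t ≤ α) (𝒜 : Finset (Finset ℕ))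
    (hd : IsDesign Λ α t 1 𝒜) :
    (Finset.Icc 1 Λ).card = Λ ∧
    ((𝒜 ×ˢ (Finset.Icc 1 Λ).powerset).filter
        fun c => c.2 ⊆ c.1 ∧ c.2.card = t).card = Nat.choose Λ t ∧
    (∀ T' : Finset ℕ,
      (∃ l ∈ Finset.Icc 1 Λ, ∃ A ∈ 𝒜, ∃ U ⊆ A, U.card = t ∧ l ∉ A ∧ insert l U = T') →
      {p : ℕ × Finset ℕ × Finset ℕ |
          p.1 ∈ Finset.Icc 1 Λ ∧ p.2.1 ∈ 𝒜 ∧ p.2.2 ⊆ p.2.1 ∧ p.2.2.card = t ∧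
          p.1 ∉ p.2.1 ∧ insert p.1 p.2.2 = T'}.ncard = t + 1) ∧
    (∀ l₁ l₂ : ℕ, ∀ A₁ A₂ U₁ U₂ : Finset ℕ,
      l₁ ∈ Finset.Icc 1 Λ → l₂ ∈ Finset.Icc 1 Λ →
      A₁ ∈ 𝒜 → A₂ ∈ 𝒜 → U₁ ⊆ A₁ → U₂ ⊆ A₂ → U₁.card = t → U₂.card = t →
      l₁ ∉ A₁ → l₂ ∉ A₂ → insert l₁ U₁ = insert l₂ U₂ →
      (l₁, A₁, U₁) ≠ (l₂, A₂, U₂) →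
      l₁ ≠ l₂ ∧ (A₁, U₁) ≠ (A₂, U₂) ∧ l₁ ∈ A₂ ∧ l₂ ∈ A₁) ∧
    (t + 1) * {T' : Finset ℕ | ∃ l ∈ Finset.Icc 1 Λ, ∃ A ∈ 𝒜, ∃ U ⊆ A,
        U.card = t ∧ l ∉ A ∧ insert l U = T'}.ncard = Nat.choose Λ t * (Λ - α) := by
  obtain ⟨hd1, hd2⟩ := hd
  have hb : ∀ T : Finset ℕ, ∃ B : Finset ℕ, T ⊆ Finset.Icc 1 Λ → T.card = t →
      B ∈ 𝒜 ∧ T ⊆ B ∧ ∀ A ∈ 𝒜, T ⊆ A → A = B := by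
    intro T
    by_cases h : T ⊆ Finset.Icc 1 Λ ∧ T.card = t
    · obtain ⟨B, hB⟩ := Finset.card_eq_one.mp (hd2 T h.1 h.2)
      refine ⟨B, fun _ _ => ?_⟩
      have h1 : ∀ A, A ∈ 𝒜 ∧ T ⊆ A ↔ A = B := by
        intro A
        have := Finset.ext_iff.mp hB A
        simpa using this
      exact ⟨((h1 B).2 rfl).1, ((h1 B).2 rfl).2, fun A hA hT => (h1 A).1 ⟨hA, hT⟩⟩
    · exact ⟨∅, fun h1 h2 => absurd ⟨h1, h2⟩ h⟩
  choose b hb using hb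
  have huniq : ∀ A ∈ 𝒜, ∀ B ∈ 𝒜, ∀ U : Finset ℕ, U.card = t → U ⊆ A → U ⊆ B → A = B := by
    intro A hA B hB U hU hUA hUB
    have h := hb U (hUA.trans (hd1 A hA).1) hU
    rw [h.2.2 A hA hUA, h.2.2 B hB hUB]
  have hcols : ((𝒜 ×ˢ (Finset.Icc 1 Λ).powerset).filter
        fun c => c.2 ⊆ c.1 ∧ c.2.card = t).card = Nat.choose Λ t := by
    have h0 : (Finset.powersetCard t (Finset.Icc 1 Λ)).card = Nat.choose Λ t := by simp
    rw [← h0]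
    refine Finset.card_bij (fun c _ => c.2) ?_ ?_ ?_
    · rintro ⟨A, U⟩ h
      simp only [Finset.mem_filter, Finset.mem_product, Finset.mem_powerset] at h
      exact Finset.mem_powersetCard.2 ⟨h.1.2, h.2.2⟩
    · rintro ⟨A, U⟩ h ⟨A', U'⟩ h' (e : U = U')
      simp only [Finset.mem_filter, Finset.mem_product, Finset.mem_powerset] at h h'
      subst e
      rw [huniq A h.1.1 A' h'.1.1 U h.2.2 h.2.1 h'.2.1]
    · intro U hU
      rw [Finset.mem_powersetCard] at hU
      have h := hb U hU.1 hU.2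
      refine ⟨(b U, U), ?_, rfl⟩
      simp only [Finset.mem_filter, Finset.mem_product, Finset.mem_powerset]
      exact ⟨⟨h.1, hU.1⟩, h.2.1, hU.2⟩
  have hfib : ∀ T' : Finset ℕ,
      (∃ l ∈ Finset.Icc 1 Λ, ∃ A ∈ 𝒜, ∃ U ⊆ A, U.card = t ∧ l ∉ A ∧ insert l U = T') →
      {p : ℕ × Finset ℕ × Finset ℕ |
          p.1 ∈ Finset.Icc 1 Λ ∧ p.2.1 ∈ 𝒜 ∧ p.2.2 ⊆ p.2.1 ∧ p.2.2.card = t ∧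
          p.1 ∉ p.2.1 ∧ insert p.1 p.2.2 = T'}.ncard = t + 1 := by
    rintro T' ⟨l, hl, A, hA, U, hUA, hU, hlA, rfl⟩
    have hlU : l ∉ U := fun h => hlA (hUA h)
    have hnot : ∀ B ∈ 𝒜, ¬ insert l U ⊆ B := by
      intro B hB h
      have e := huniq A hA B hB U hU hUA ((Finset.subset_insert _ _).trans h)
      exact hlA (e ▸ h (Finset.mem_insert_self _ _))
    have hcard : (insert l U).card = t + 1 := by rw [Finset.card_insert_of_notMem hlU, hU]
    have hsub : insert l U ⊆ Finset.Icc 1 Λ :=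
      Finset.insert_subset hl (hUA.trans (hd1 A hA).1)
    generalize insert l U = T' at *
    have hE : {p : ℕ × Finset ℕ × Finset ℕ |
          p.1 ∈ Finset.Icc 1 Λ ∧ p.2.1 ∈ 𝒜 ∧ p.2.2 ⊆ p.2.1 ∧ p.2.2.card = t ∧
          p.1 ∉ p.2.1 ∧ insert p.1 p.2.2 = T'} =
        ((T'.image fun x => (x, b (T'.erase x), T'.erase x) :
          Finset (ℕ × Finset ℕ × Finset ℕ)) : Set (ℕ × Finset ℕ × Finset ℕ)) := by
      ext ⟨x, B, V⟩
      simp only [Set.mem_ofPred_eq, Finset.coe_image, Set.mem_image, Finset.mem_coe, Prod.mk.injEq]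
      constructor
      · rintro ⟨hx, hB, hVB, hV, hxB, rfl⟩
        have hxV : x ∉ V := fun h => hxB (hVB h)
        refine ⟨x, Finset.mem_insert_self _ _, rfl, ?_, Finset.erase_insert hxV⟩
        rw [Finset.erase_insert hxV]
        exact ((hb V (hVB.trans (hd1 B hB).1) hV).2.2 B hB hVB).symm
      · rintro ⟨y, hy, rfl, rfl, rfl⟩
        have hc : (T'.erase y).card = t := by rw [Finset.card_erase_of_mem hy, hcard]; rfl
        have h := hb (T'.erase y) ((Finset.erase_subset _ _).trans hsub) hc
        refine ⟨hsub hy, h.1, h.2.1, hc, fun hyb => hnot _ h.1 ?_, Finset.insert_erase hy⟩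
        rw [← Finset.insert_erase hy]
        rw [Finset.insert_erase hy]
        intro z hz
        by_cases e : z = y
        · exact e ▸ hyb
        · exact h.2.1 (Finset.mem_erase.2 ⟨e, hz⟩)
    rw [hE, Set.ncard_coe_finset, Finset.card_image_of_injective, hcard]
    intro x y h
    exact (Prod.mk.inj h).1
  refine ⟨by simp, hcols, hfib, ?_, ?_⟩
  · intro l₁ l₂ A₁ A₂ U₁ U₂ hl₁ hl₂ hA₁ hA₂ hU₁ hU₂ hc₁ hc₂ hn₁ hn₂ he hne
    have hm₁ : l₁ ∉ U₁ := fun h => hn₁ (hU₁ h)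
    have hm₂ : l₂ ∉ U₂ := fun h => hn₂ (hU₂ h)
    have hll : l₁ ≠ l₂ := by
      rintro rfl
      have hUU : U₁ = U₂ := by
        rw [← Finset.erase_insert hm₁, he, Finset.erase_insert hm₂]
      subst hUU
      exact hne (by rw [huniq A₁ hA₁ A₂ hA₂ U₁ hc₁ hU₁ hU₂])
    have h1 : l₁ ∈ U₂ := by
      have : l₁ ∈ insert l₂ U₂ := he ▸ Finset.mem_insert_self _ _
      exact (Finset.mem_insert.1 this).resolve_left hll
    have h2 : l₂ ∈ U₁ := by
      have : l₂ ∈ insert l₁ U₁ := he ▸ Finset.mem_insert_self _ _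
      exact (Finset.mem_insert.1 this).resolve_left hll.symm
    refine ⟨hll, ?_, hU₂ h1, hU₁ h2⟩
    intro e
    exact hm₁ ((Prod.mk.inj e).2 ▸ h1)
  · let P : Finset (ℕ × Finset ℕ × Finset ℕ) :=
      (Finset.Icc 1 Λ ×ˢ ((𝒜 ×ˢ (Finset.Icc 1 Λ).powerset).filter
        fun c => c.2 ⊆ c.1 ∧ c.2.card = t)).filter fun p => p.1 ∉ p.2.1
    have hP : ∀ x B V, (x, B, V) ∈ P ↔
        x ∈ Finset.Icc 1 Λ ∧ B ∈ 𝒜 ∧ V ⊆ B ∧ V.card = t ∧ x ∉ B := by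
      intro x B V
      simp only [P, Finset.mem_filter, Finset.mem_product, Finset.mem_powerset]
      constructor
      · rintro ⟨⟨h1, ⟨h2, h3⟩, h4, h5⟩, h6⟩
        exact ⟨h1, h2, h4, h5, h6⟩
      · rintro ⟨h1, h2, h4, h5, h6⟩
        exact ⟨⟨h1, ⟨h2, h4.trans (hd1 B h2).1⟩, h4, h5⟩, h6⟩
    have hS : {T' : Finset ℕ | ∃ l ∈ Finset.Icc 1 Λ, ∃ A ∈ 𝒜, ∃ U ⊆ A,
        U.card = t ∧ l ∉ A ∧ insert l U = T'} =
        ((P.image fun p => insert p.1 p.2.2 : Finset (Finset ℕ)) : Set (Finset ℕ)) := by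
      ext T'
      simp only [Set.mem_ofPred_eq, Finset.coe_image, Set.mem_image, Finset.mem_coe]
      constructor
      · rintro ⟨l, hl, A, hA, U, hUA, hU, hlA, e⟩
        exact ⟨(l, A, U), (hP _ _ _).2 ⟨hl, hA, hUA, hU, hlA⟩, e⟩
      · rintro ⟨⟨l, A, U⟩, h, e⟩
        obtain ⟨hl, hA, hUA, hU, hlA⟩ := (hP _ _ _).1 h
        exact ⟨l, hl, A, hA, U, hUA, hU, hlA, e⟩
    have hc1 : P.card = (P.image fun p => insert p.1 p.2.2).card * (t + 1) := by
      rw [Finset.card_eq_sum_card_image (fun p => insert p.1 p.2.2) P]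
      refine Finset.sum_const_nat ?_
      intro T' hT'
      have hmem : T' ∈ {T' : Finset ℕ | ∃ l ∈ Finset.Icc 1 Λ, ∃ A ∈ 𝒜, ∃ U ⊆ A,
        U.card = t ∧ l ∉ A ∧ insert l U = T'} := by
        rw [hS]; exact hT'
      rw [← hfib T' hmem, ← Set.ncard_coe_finset]
      congr 1
      ext ⟨x, B, V⟩
      simp only [Finset.coe_filter, Set.mem_ofPred_eq, hP]
      tauto
    have hc2 : P.card = Nat.choose Λ t * (Λ - α) := by
      rw [← hcols, Finset.card_eq_sum_card_fiberwise (f := fun p => p.2)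
        (t := (𝒜 ×ˢ (Finset.Icc 1 Λ).powerset).filter fun c => c.2 ⊆ c.1 ∧ c.2.card = t)]
      · refine Finset.sum_const_nat ?_
        rintro ⟨B, V⟩ h
        have hB := hd1 B (Finset.mem_product.1 (Finset.mem_filter.1 h).1).1
        have hcd : (Finset.Icc 1 Λ \ B).card = Λ - α := by
          rw [Finset.card_sdiff_of_subset hB.1, hB.2]; simp
        rw [← hcd]
        refine Finset.card_bij (fun p _ => p.1) ?_ ?_ ?_
        · rintro ⟨x, B', V'⟩ hx
          obtain ⟨hxP, e⟩ := Finset.mem_filter.1 hx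
          obtain ⟨rfl, rfl⟩ := Prod.mk.inj e
          have := (hP _ _ _).1 hxP
          exact Finset.mem_sdiff.2 ⟨this.1, this.2.2.2.2⟩
        · rintro ⟨x, c⟩ hx ⟨y, c'⟩ hy (e : x = y)
          have h1 : c = (B, V) := (Finset.mem_filter.1 hx).2
          have h2 : c' = (B, V) := (Finset.mem_filter.1 hy).2
          rw [e, h1, h2]
        · intro x hx
          rw [Finset.mem_sdiff] at hx
          refine ⟨(x, B, V), Finset.mem_filter.2 ⟨Finset.mem_filter.2
            ⟨Finset.mem_product.2 ⟨hx.1, h⟩, hx.2⟩, rfl⟩, rfl⟩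
      · intro p hp
        exact (Finset.mem_product.1 (Finset.mem_filter.1 hp).1).2
    rw [hS, Set.ncard_coe_finset, mul_comm, ← hc1, hc2]
end

section
/- Let Λ, α, t be positive integers with Λ > α ≥ t and let 𝒜 be a t-(Λ, α, 1) design on X = {1, …, Λ}. Fix a block A ∈ 𝒜 and a non-star entry of the array P_{Λ,t} in a column (A, U_A) of A, say in row λ (so λ ∉ A, U_A ⊆ A, |U_A| = t). Then for every other position (λᵢ, (Aᵢ, U_{Aᵢ})) of the array carrying the same non-star entry (so Aᵢ ≠ A or the column differs), one has λᵢ ∈ A; that is, the reducer node indexed by block A is connected to the mapper node λᵢ and hence can access the batch B_{λᵢ} needed to form its coded transmission for that entry. -/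
/-- Fix a non-star entry of `P_{Λ,t}` in row `l` and a column `(A, U_A)` of block `A`.
Every other position `(lᵢ, (Aᵢ, U_{Aᵢ}))` carrying the same non-star entry satisfies
`lᵢ ∈ A`: reducer node `A` is connected to mapper node `lᵢ`, so it can access the
batch `B_{lᵢ}` needed to form its coded transmission for that entry. -/
theorem reducer_accesses_needed_batches (Λ α t : ℕ) (hΛ : 0 < Λ) (hα : 0 < α)
    (ht : 0 < t) (hαΛ : α < Λ) (htα : t ≤ α) (𝒜 : Finset (Finset ℕ))
    (hd : IsDesign Λ α t 1 𝒜)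
    (l : ℕ) (A U_A : Finset ℕ)
    (hl : l ∈ Finset.Icc 1 Λ) (hA : A ∈ 𝒜) (hUA : U_A ⊆ A) (hUAc : U_A.card = t)
    (hlA : l ∉ A) :
    ∀ lᵢ ∈ Finset.Icc 1 Λ, ∀ Aᵢ ∈ 𝒜, ∀ Uᵢ ⊆ Aᵢ, Uᵢ.card = t → lᵢ ∉ Aᵢ →
      insert lᵢ Uᵢ = insert l U_A → (Aᵢ, Uᵢ) ≠ (A, U_A) → lᵢ ∈ A := by
  intro k _ B hB V hVB hVc hkB heq hne
  by_cases h : k = l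
  · exfalso
    subst h
    have hV : V = U_A := by
      have h1 : k ∉ V := fun h => hkB (hVB h)
      have h2 : k ∉ U_A := fun h => hlA (hUA h)
      rw [← Finset.erase_insert h1, heq, Finset.erase_insert h2]
    subst hV
    have hc := hd.2 V (hUA.trans (hd.1 A hA).1) hUAc
    have hBA : B = A := Finset.card_le_one.mp hc.le B
      (Finset.mem_filter.mpr ⟨hB, hVB⟩) A (Finset.mem_filter.mpr ⟨hA, hUA⟩)
    exact hne (by rw [hBA])
  · have hk : k ∈ insert l U_A := heq ▸ Finset.mem_insert_self k V
    exact hUA ((Finset.mem_insert.mp hk).resolve_left h)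
end
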